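/- For any z ∈ V and any ρ ∈ Rec(z), the probability P_{s_0}{ R_z(s_τ) = ρ } converges, as |s_0| → −∞, to (1/κ)·Σ_{i∈V} α_i·av_{i→z}(ρ); i.e., the limiting law of the z-recurrent representative of the threshold state is the size-biasing of the uniform distribution on Rec(z) by average burst size. -/

import Mathlib

open scoped BigOperators
open Classical Filter

noncomputable section

namespace ThresholdState

variable {V : Type*} [Fintype V] [DecidableEq V]

/-- `A i j` is the number of directed edges from `i` to `j`. -/
def outdeg (A : V → V → ℕ) (i : V) : ℕ := ∑ j, A i j

def indeg (A : V → V → ℕ) (i : V) : ℕ := ∑ j, A j i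

/-- Eulerian: out-degree equals in-degree at every vertex. -/
def Eulerian (A : V → V → ℕ) : Prop := ∀ i, outdeg A i = indeg A i

/-- (Strongly) connected multigraph. -/
def Connected (A : V → V → ℕ) : Prop :=
  ∀ i j : V, Relation.ReflTransGen (fun a b => 0 < A a b) i j

def deg (A : V → V → ℕ) (i : V) : ℕ := outdeg A i

/-- Graph Laplacian: `Δu(i) = -deg(i)·u(i) + Σ_{e incoming to i} u(e⁻)`. -/
def lap (A : V → V → ℕ) (u : V → ℤ) (i : V) : ℤ :=
  -(deg A i : ℤ) * u i + ∑ j, (A j i : ℤ) * u j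

def delta (z : V) : V → ℤ := fun j => if j = z then 1 else 0

/-- Toppling vertex `i`: replace `s` by `s + Δδ_i`. -/
def toppleAt (A : V → V → ℕ) (s : V → ℤ) (i : V) : V → ℤ :=
  fun j => s j + lap A (delta i) j

def applySeq (A : V → V → ℕ) (s : V → ℤ) (l : List V) : V → ℤ :=
  l.foldl (toppleAt A) s

/-- A legal toppling sequence (avoiding the forbidden set `F`): each toppled
vertex is unstable when toppled and does not lie in `F`. -/
def ValidSeq (A : V → V → ℕ) (F : V → Prop) : (V → ℤ) → List V → Prop
  | _, [] => True
  | s, i :: l => ¬ F i ∧ (deg A i : ℤ) ≤ s i ∧ ValidSeq A F (toppleAt A s i) l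

/-- Stable at every non-forbidden vertex. -/
def StableOff (A : V → V → ℕ) (F : V → Prop) (s : V → ℤ) : Prop :=
  ∀ i, ¬ F i → s i ≤ (deg A i : ℤ) - 1

def StabilizesTo (A : V → V → ℕ) (F : V → Prop) (s : V → ℤ) (l : List V) : Prop :=
  ValidSeq A F s l ∧ StableOff A F (applySeq A s l)

def StabilizableVia (A : V → V → ℕ) (F : V → Prop) (s : V → ℤ) : Prop :=
  ∃ l, StabilizesTo A F s l

/-- Stabilizable with no forbidden vertices. -/
def Stabilizable (A : V → V → ℕ) (s : V → ℤ) : Prop :=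
  StabilizableVia A (fun _ => False) s

def stabSeq (A : V → V → ℕ) (F : V → Prop) (s : V → ℤ) : List V :=
  if h : StabilizableVia A F s then h.choose else []

def stabilizeVia (A : V → V → ℕ) (F : V → Prop) (s : V → ℤ) : V → ℤ :=
  applySeq A s (stabSeq A F s)

/-- Odometer: number of topplings at each vertex (`0` everywhere if not stabilizable). -/
def odometerVia (A : V → V → ℕ) (F : V → Prop) (s : V → ℤ) : V → ℕ :=
  fun i => (stabSeq A F s).count i

def sinkStabilize (A : V → V → ℕ) (z : V) (s : V → ℤ) : V → ℤ :=
  stabilizeVia A (fun i => i = z) s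

def sinkOdometer (A : V → V → ℕ) (z : V) (s : V → ℤ) : V → ℕ :=
  odometerVia A (fun i => i = z) s

/-- `ρ` is `z`-recurrent (Dhar's burning test): `ρ(z) = deg z`, `ρ(i) ≤ deg i - 1`
off the sink, and every site other than `z` topples exactly once in the
stabilization of `ρ + Δδ_z` with sink `z`. -/
def ZRec (A : V → V → ℕ) (z : V) (ρ : V → ℤ) : Prop :=
  ρ z = (deg A z : ℤ) ∧ (∀ i, i ≠ z → ρ i ≤ (deg A i : ℤ) - 1) ∧
  ∃ l : List V, StabilizesTo A (fun i => i = z) (fun j => ρ j + lap A (delta z) j) l ∧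
    ∀ i, i ≠ z → l.count i = 1

/-- `κ` = number of `z`-recurrent sandpiles. -/
def kappa (A : V → V → ℕ) (z : V) : ℕ := Nat.card {ρ : V → ℤ // ZRec A z ρ}

def totalMass (s : V → ℤ) : ℤ := ∑ i, s i

/-- Open addition operator `â_i` (with sink `z`). -/
def openAdd (A : V → V → ℕ) (z i : V) (ρ : V → ℤ) : V → ℤ :=
  fun j => if j = z then (deg A z : ℤ) else sinkStabilize A z (fun k => ρ k + delta i k) j

/-- `â_i⁻¹` on `Rec(z)`. -/
def openAddInv (A : V → V → ℕ) (z i : V) (ρ : V → ℤ) : V → ℤ :=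
  if h : ∃ ρ', ZRec A z ρ' ∧ openAdd A z i ρ' = ρ then h.choose else ρ

/-- Burst size `av_{i→z}(ρ) = |â_i⁻¹ρ| - |ρ| + 1`. -/
def burst (A : V → V → ℕ) (z i : V) (ρ : V → ℤ) : ℤ :=
  totalMass (openAddInv A z i ρ) - totalMass ρ + 1

/-- The `z`-recurrent decomposition `s = ρ + m·δ_z + Δv` with `ρ ∈ Rec(z)`, `v(z)=0`. -/
def ZDecomp (A : V → V → ℕ) (z : V) (s ρ : V → ℤ) (m : ℤ) (v : V → ℤ) : Prop :=
  ZRec A z ρ ∧ v z = 0 ∧ ∀ j, s j = ρ j + m * delta z j + lap A v j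

/-- `R_z(s)`: the `z`-recurrent representative of `s`. -/
def Rz (A : V → V → ℕ) (z : V) (s : V → ℤ) : V → ℤ :=
  if h : ∃ ρ, ∃ m, ∃ v, ZDecomp A z s ρ m v then h.choose else s

/-- `m_z(s)`: the integer in the `z`-recurrent decomposition of `s`. -/
def mz (A : V → V → ℕ) (z : V) (s : V → ℤ) : ℤ :=
  if h : ∃ m, ∃ ρ, ∃ v, ZDecomp A z s ρ m v then h.choose else 0

/-- Closed addition operator `a_i`. -/
def closedAdd (A : V → V → ℕ) (i : V) (s : V → ℤ) : V → ℤ :=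
  if Stabilizable A (fun j => s j + delta i j) then
    stabilizeVia A (fun _ => False) (fun j => s j + delta i j)
  else fun j => s j + delta i j

/-- The closed chain after making the additions listed in `w` (in order). -/
def chain (A : V → V → ℕ) (s0 : V → ℤ) (w : List V) : V → ℤ :=
  w.foldl (fun s i => closedAdd A i s) s0

/-- `w` is a threshold word for `s0`: the chain first becomes non-stabilizable
exactly after the additions in `w`, i.e. `τ = |w|` on the cylinder of `w`. -/
def IsThresholdWord (A : V → V → ℕ) (s0 : V → ℤ) (w : List V) : Prop :=
  ¬ Stabilizable A (chain A s0 w) ∧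
  ∀ w' : List V, w' <+: w → w' ≠ w → Stabilizable A (chain A s0 w')

def wordProb (α : V → ℝ) (w : List V) : ℝ := (w.map α).prod

/-- `P_{s0}(E at the threshold time)`: total probability of the (disjoint)
cylinders of threshold words satisfying `E`. -/
def thresholdProb (A : V → V → ℕ) (α : V → ℝ) (s0 : V → ℤ) (E : List V → Prop) : ℝ :=
  ∑' w : List V, if IsThresholdWord A s0 w ∧ E w then wordProb α w else 0

/-- `E_{s0}[f at the threshold time]`. -/
def thresholdExp (A : V → V → ℕ) (α : V → ℝ) (s0 : V → ℤ) (f : List V → ℝ) : ℝ :=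
  ∑' w : List V, if IsThresholdWord A s0 w then wordProb α w * f w else 0

end ThresholdState

namespace ThresholdState

set_option linter.unusedSectionVars false

section Laplacian

variable {V : Type*} [Fintype V] [DecidableEq V] (A : V → V → ℕ)

/-- The graph Laplacian as a linear map. -/
def lapLin : (V → ℤ) →ₗ[ℤ] (V → ℤ) where
  toFun := lap A
  map_add' u v := by
    funext i
    simp only [lap, Pi.add_apply, mul_add, Finset.sum_add_distrib]
    ring
  map_smul' c u := by
    funext i
    simp only [lap, Pi.smul_apply, smul_eq_mul, RingHom.id_apply, mul_add, Finset.mul_sum]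
    congr 1
    · ring
    · exact Finset.sum_congr rfl fun j _ => by ring

theorem lap_add (u v : V → ℤ) : lap A (u + v) = lap A u + lap A v := (lapLin A).map_add u v

theorem lap_sub (u v : V → ℤ) : lap A (u - v) = lap A u - lap A v := (lapLin A).map_sub u v

theorem lap_neg (u : V → ℤ) : lap A (-u) = -lap A u := (lapLin A).map_neg u

theorem lap_zero : lap A (0 : V → ℤ) = 0 := (lapLin A).map_zero

theorem lap_smul (c : ℤ) (u : V → ℤ) : lap A (c • u) = c • lap A u := (lapLin A).map_smul c u

theorem delta_self (i : V) : delta i i = 1 := by simp [delta]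

theorem delta_of_ne {i j : V} (h : j ≠ i) : delta i j = 0 := by simp [delta, h]

theorem delta_nonneg (i j : V) : 0 ≤ delta i j := by unfold delta; split_ifs <;> simp

theorem sum_delta (i : V) : ∑ j, delta i j = 1 := by simp [delta]

theorem toppleAt_eq (s : V → ℤ) (i : V) : toppleAt A s i = s + lap A (delta i) := rfl

theorem sum_lap (u : V → ℤ) : ∑ i, lap A u i = 0 := by
  simp only [lap, Finset.sum_add_distrib]
  rw [Finset.sum_comm]
  simp only [deg, outdeg, Nat.cast_sum, Finset.sum_mul, neg_mul, Finset.sum_neg_distrib]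
  ring

variable {A}

theorem lap_nonneg_of_eq_zero {u : V → ℤ} (hu : ∀ i, 0 ≤ u i) {i : V} (hi : u i = 0) :
    0 ≤ lap A u i := by
  simp only [lap, hi, mul_zero, zero_add]
  exact Finset.sum_nonneg fun j _ => mul_nonneg (by positivity) (hu j)

theorem lap_eq_sum_sub (hEul : Eulerian A) (u : V → ℤ) (i : V) :
    lap A u i = ∑ j, (A j i : ℤ) * (u j - u i) := by
  have h := hEul i
  simp only [lap, deg, h, indeg, Nat.cast_sum, mul_sub, Finset.sum_sub_distrib, neg_mul,
    Finset.sum_mul]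
  ring

theorem lap_const (hEul : Eulerian A) (c : ℤ) : lap A (fun _ => c) = 0 := by
  funext i
  simp [lap_eq_sum_sub hEul]

theorem lap_nonneg_of_isMin (hEul : Eulerian A) {u : V → ℤ} {i : V} (hi : ∀ j, u i ≤ u j) :
    0 ≤ lap A u i := by
  rw [lap_eq_sum_sub hEul]
  exact Finset.sum_nonneg fun j _ => mul_nonneg (by positivity) (sub_nonneg.2 (hi j))

theorem eq_of_lap_eq_zero (hEul : Eulerian A) (hConn : Connected A) {u : V → ℤ}
    (hu : lap A u = 0) (i j : V) : u i = u j := by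
  obtain ⟨m, -, hm⟩ := Finset.exists_min_image Finset.univ u ⟨i, Finset.mem_univ i⟩
  replace hm : ∀ k, u m ≤ u k := fun k => hm k (Finset.mem_univ k)
  suffices h : ∀ k, u k = u m by rw [h i, h j]
  intro k
  refine Relation.ReflTransGen.head_induction_on (hConn k m) rfl ?_
  intro a c hac _ hc
  have h0 : lap A u c = 0 := congrFun hu c
  rw [lap_eq_sum_sub hEul,
    Finset.sum_eq_zero_iff_of_nonneg
      fun j _ => mul_nonneg (by positivity) (by rw [hc]; exact sub_nonneg.2 (hm j))] at h0
  have := h0 a (Finset.mem_univ a)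
  rcases mul_eq_zero.1 this with h | h
  · exact absurd (by exact_mod_cast h) hac.ne'
  · rw [← hc]; linarith

/-- A function whose Laplacian is a positive constant away from `z`. -/
theorem exists_lap_pos (hEul : Eulerian A) (hConn : Connected A) (z : V) :
    ∃ g : V → ℤ, ∀ i, i ≠ z → 1 ≤ lap A g i := by
  let f : (V → ℤ) →ₗ[ℤ] (V → ℤ) :=
    { toFun := fun u i => if i = z then u z else lap A u i
      map_add' := fun u v => by
        funext i
        simp only [lap_add, Pi.add_apply]
        split_ifs <;> simp
      map_smul' := fun c u => by
        funext i
        simp only [lap_smul, Pi.smul_apply, RingHom.id_apply]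
        split_ifs <;> simp }
  have hker : ∀ u, f u = 0 → u = 0 := by
    intro u hu
    have hz : u z = 0 := by simpa [f] using congrFun hu z
    have hoff : ∀ i, i ≠ z → lap A u i = 0 := fun i hi => by simpa [f, hi] using congrFun hu i
    have hlap : lap A u = 0 := by
      funext i
      by_cases hi : i = z
      · subst hi
        have := sum_lap A u
        rwa [Finset.sum_eq_single i (fun j _ hj => hoff j hj) (by simp)] at this
      · exact hoff i hi
    funext i
    rw [eq_of_lap_eq_zero hEul hConn hlap i z, hz]; rfl
  set M := LinearMap.toMatrix' f with hM
  have hMv : ∀ u, M.mulVec u = f u := fun u => by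
    rw [hM, ← Matrix.toLin'_apply, Matrix.toLin'_toMatrix']
  have hdet : M.det ≠ 0 := by
    intro h
    obtain ⟨v, hv, hv0⟩ := Matrix.exists_mulVec_eq_zero_iff.2 h
    exact hv (hker v (by rw [← hMv, hv0]))
  refine ⟨M.adjugate.mulVec fun _ => M.det, fun i hi => ?_⟩
  have h := hMv (M.adjugate.mulVec fun _ => M.det)
  rw [Matrix.mulVec_mulVec, Matrix.mul_adjugate, Matrix.smul_mulVec, Matrix.one_mulVec] at h
  have h' := congrFun h i
  simp only [Pi.smul_apply, smul_eq_mul, f, LinearMap.coe_mk, AddHom.coe_mk, hi, if_false] at h'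
  rw [← h']
  have := mul_self_pos.2 hdet
  linarith

end Laplacian

section Stabilization

variable {V : Type*} [Fintype V] [DecidableEq V] {A : V → V → ℕ} {F : V → Prop}

/-- The number of occurrences of each vertex in a toppling sequence. -/
def counts (l : List V) : V → ℤ := fun i => (l.count i : ℤ)

theorem counts_nonneg (l : List V) (i : V) : 0 ≤ counts l i := Int.natCast_nonneg _

theorem counts_cons (i : V) (l : List V) : counts (i :: l) = delta i + counts l := by
  funext j
  simp only [counts, delta, List.count_cons, Pi.add_apply, beq_iff_eq, eq_comm (a := i)]
  split_ifs <;> push_cast <;> ring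

theorem applySeq_eq (s : V → ℤ) (l : List V) : applySeq A s l = s + lap A (counts l) := by
  induction l generalizing s with
  | nil =>
    have : counts ([] : List V) = 0 := by funext i; simp [counts]
    rw [this, lap_zero, add_zero]; rfl
  | cons i l ih =>
    rw [counts_cons, lap_add, ← add_assoc, ← toppleAt_eq, ← ih]; rfl

theorem ValidSeq.counts_eq_zero {s : V → ℤ} {l : List V} (h : ValidSeq A F s l) {i : V}
    (hi : F i) : counts l i = 0 := by
  induction l generalizing s with
  | nil => simp [counts]
  | cons j l ih =>
    have hne : i ≠ j := by rintro rfl; exact h.1 hi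
    rw [counts_cons, Pi.add_apply, delta_of_ne hne, ih h.2.2, add_zero]

theorem one_le_of_unstable {s w : V → ℤ} (hw : ∀ i, 0 ≤ w i)
    (hs : StableOff A F (s + lap A w)) {i : V} (hi : ¬ F i) (hdeg : (deg A i : ℤ) ≤ s i) :
    1 ≤ w i := by
  by_contra h
  have h0 : w i = 0 := le_antisymm (by omega) (hw i)
  have := lap_nonneg_of_eq_zero (A := A) hw h0
  have := hs i hi
  simp only [Pi.add_apply] at this
  omega

theorem sub_delta_nonneg {w : V → ℤ} (hw : ∀ i, 0 ≤ w i) {i : V} (hi : 1 ≤ w i) (j : V) :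
    0 ≤ (w - delta i) j := by
  by_cases h : j = i
  · subst h; simp only [Pi.sub_apply, delta_self]; omega
  · simp only [Pi.sub_apply, delta_of_ne h, sub_zero]; exact hw j

theorem toppleAt_add_lap_sub (s w : V → ℤ) (i : V) :
    toppleAt A s i + lap A (w - delta i) = s + lap A w := by
  rw [toppleAt_eq, lap_sub]; abel

/-- Least action principle. -/
theorem ValidSeq.counts_le {s w : V → ℤ} {l : List V} (hl : ValidSeq A F s l)
    (hw : ∀ i, 0 ≤ w i) (hs : StableOff A F (s + lap A w)) (i : V) : counts l i ≤ w i := by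
  induction l generalizing s w with
  | nil => simpa [counts] using hw i
  | cons j l ih =>
    have hj := one_le_of_unstable hw hs hl.1 hl.2.1
    have := ih hl.2.2 (w := w - delta j) (sub_delta_nonneg hw hj)
      (by rwa [toppleAt_add_lap_sub])
    rw [counts_cons]
    simp only [Pi.add_apply, Pi.sub_apply] at this ⊢
    omega

theorem stabilizableVia_of_stableOff {s w : V → ℤ} (hw : ∀ i, 0 ≤ w i)
    (hs : StableOff A F (s + lap A w)) : StabilizableVia A F s := by
  obtain ⟨n, hn⟩ : ∃ n : ℕ, ∑ i, w i ≤ n := ⟨(∑ i, w i).toNat, Int.self_le_toNat _⟩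
  induction n generalizing s w with
  | zero =>
    by_cases h : StableOff A F s
    · exact ⟨[], trivial, h⟩
    · simp only [StableOff, not_forall] at h
      obtain ⟨i, hi, h⟩ := h
      have h1 := one_le_of_unstable hw hs hi (by omega)
      have := Finset.single_le_sum (fun j _ => hw j) (Finset.mem_univ i)
      norm_num at hn
      omega
  | succ n ih =>
    by_cases h : StableOff A F s
    · exact ⟨[], trivial, h⟩
    · simp only [StableOff, not_forall] at h
      obtain ⟨i, hi, h⟩ := h
      have h1 := one_le_of_unstable hw hs hi (by omega)
      obtain ⟨l, hl, hl'⟩ := ih (s := toppleAt A s i) (w := w - delta i) (sub_delta_nonneg hw h1)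
        (by rwa [toppleAt_add_lap_sub])
        (by simp only [Pi.sub_apply, Finset.sum_sub_distrib, sum_delta]; push_cast at hn; omega)
      exact ⟨i :: l, ⟨hi, by omega, hl⟩, hl'⟩

end Stabilization

section Recurrence

variable {V : Type*} [Fintype V] [DecidableEq V] {A : V → V → ℕ} {z : V}

/-- No reverse toppling supported off `z` leaves `s` stable off `z`. Together with stability this
characterizes recurrence, see `ZRec.burning` and `zRec_of_burning`. -/
def Burning (A : V → V → ℕ) (z : V) (s : V → ℤ) : Prop :=
  ∀ u : V → ℤ, u z = 0 → (∃ i, 0 < u i) → ∃ i, i ≠ z ∧ (deg A i : ℤ) ≤ s i - lap A u i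

theorem Burning.mono {s t : V → ℤ} (hs : Burning A z s) (h : ∀ i, i ≠ z → s i ≤ t i) :
    Burning A z t := by
  intro u hz hu
  obtain ⟨i, hi, hle⟩ := hs u hz hu
  exact ⟨i, hi, hle.trans (sub_le_sub_right (h i hi) _)⟩

theorem exists_argmax {u : V → ℤ} (hz : u z = 0) (hu : ∃ i, 0 < u i) :
    ∃ m, m ≠ z ∧ 0 < u m ∧ ∀ j, u j ≤ u m := by
  obtain ⟨m, -, hm⟩ := Finset.exists_max_image Finset.univ u ⟨z, Finset.mem_univ z⟩
  obtain ⟨i, hi⟩ := hu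
  have hpos : 0 < u m := hi.trans_le (hm i (Finset.mem_univ i))
  exact ⟨m, by rintro rfl; omega, hpos, fun j => hm j (Finset.mem_univ j)⟩

theorem burning_of_deg_le (hEul : Eulerian A) {s : V → ℤ}
    (hs : ∀ i, i ≠ z → (deg A i : ℤ) ≤ s i) : Burning A z s := by
  intro u hz hu
  obtain ⟨m, hmz, -, hm⟩ := exists_argmax hz hu
  have h : 0 ≤ lap A (-u) m := lap_nonneg_of_isMin hEul fun j => neg_le_neg (hm j)
  rw [lap_neg, Pi.neg_apply] at h
  exact ⟨m, hmz, by linarith [hs m hmz]⟩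

theorem Burning.add_lap_counts {s : V → ℤ} (hs : Burning A z s) {l : List V}
    (hl : ValidSeq A (fun i => i = z) s l) : Burning A z (s + lap A (counts l)) := by
  intro u hz hu
  by_contra! hcon
  have hcz : counts l z = 0 := hl.counts_eq_zero rfl
  by_cases h : ∀ i, u i ≤ counts l i
  · obtain ⟨i, hi⟩ := hu
    have := hl.counts_le (w := counts l - u) (fun j => sub_nonneg.2 (h j)) (by
      intro j hj
      have := hcon j hj
      rw [lap_sub]
      simp only [Pi.add_apply, Pi.sub_apply] at this ⊢
      omega) i
    simp only [Pi.sub_apply] at this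
    omega
  · push Not at h
    obtain ⟨i, hi, hle⟩ := hs (u - counts l) (by simp [hz, hcz])
      (h.imp fun i hi => by simpa using hi)
    have := hcon i hi
    rw [lap_sub] at hle
    simp only [Pi.add_apply, Pi.sub_apply] at this hle
    omega

theorem ZRec.burning (hEul : Eulerian A) {ρ : V → ℤ} (hρ : ZRec A z ρ) : Burning A z ρ := by
  obtain ⟨-, hst, l, ⟨hl, -⟩, hcount⟩ := hρ
  intro u hz hu
  obtain ⟨m, hmz, hpos, hm⟩ := exists_argmax hz hu
  set x : V → ℤ := fun i => if u i = u m then 1 else 0 with hx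
  have hxz : x z = 0 := by simp only [hx, hz]; rw [if_neg hpos.ne]
  by_contra! hcon
  have hx01 : ∀ i, 0 ≤ x i ∧ x i ≤ 1 := fun i => by simp only [hx]; split_ifs <;> simp
  have hw : ∀ i, 0 ≤ ((fun _ => 1) - delta z - x : V → ℤ) i := by
    intro i
    simp only [Pi.sub_apply]
    by_cases hi : i = z
    · subst hi; rw [hxz, delta_self]; norm_num
    · rw [delta_of_ne hi]; linarith [(hx01 i).2]
  have hle := hl.counts_le hw (by
    intro i hi
    rw [lap_sub, lap_sub, lap_const hEul]
    simp only [Pi.add_apply, Pi.sub_apply, Pi.zero_apply]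
    have hui := hcon i hi
    have h : ρ i - lap A x i < deg A i := by
      by_cases hxi : u i = u m
      · refine lt_of_le_of_lt ?_ hui
        refine sub_le_sub_left ?_ _
        rw [lap_eq_sum_sub hEul, lap_eq_sum_sub hEul]
        refine Finset.sum_le_sum fun j _ => mul_le_mul_of_nonneg_left ?_ (by positivity)
        simp only [hx, hxi, if_true]
        split_ifs with hj
        · rw [hj]; simp
        · have := lt_of_le_of_ne (hm j) hj; omega
      · have := lap_nonneg_of_eq_zero (A := A) (fun j => (hx01 j).1) (i := i) (by simp [hx, hxi])
        have := hst i hi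
        omega
    omega) m
  have hc : counts l m = 1 := by simp [counts, hcount m hmz]
  have hxm : x m = 1 := by simp [hx]
  simp only [Pi.sub_apply, delta_of_ne hmz, hc, hxm] at hle
  norm_num at hle

theorem zRec_of_burning (hEul : Eulerian A) {ρ : V → ℤ} (hz : ρ z = deg A z)
    (hst : ∀ i, i ≠ z → ρ i ≤ (deg A i : ℤ) - 1) (hb : Burning A z ρ) : ZRec A z ρ := by
  have hw : ∀ i, 0 ≤ ((fun _ => 1) - delta z : V → ℤ) i := by
    intro i
    by_cases hi : i = z
    · subst hi; simp [delta_self]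
    · simp [delta_of_ne hi]
  have hs : StableOff A (fun i => i = z)
      ((fun j => ρ j + lap A (delta z) j) + lap A ((fun _ => 1) - delta z)) := by
    intro i hi
    rw [lap_sub, lap_const hEul]
    simpa using hst i hi
  obtain ⟨l, hl, hl'⟩ := stabilizableVia_of_stableOff hw hs
  refine ⟨hz, hst, l, ⟨hl, hl'⟩, fun i hi => ?_⟩
  have hle := hl.counts_le hw hs
  have hcz : counts l z = 0 := hl.counts_eq_zero rfl
  have hi1 := hle i
  by_contra hne
  obtain ⟨j, hj, hdeg⟩ := hb ((fun _ => 1) - delta z - counts l)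
    (by simp [delta_self, hcz]) ⟨i, by
      have : counts l i ≠ 1 := by simpa [counts] using hne
      simp only [Pi.sub_apply, delta_of_ne hi] at hi1 ⊢
      omega⟩
  have h := hl' j hj
  rw [applySeq_eq] at h
  rw [lap_sub, lap_sub, lap_const hEul] at hdeg
  simp only [Pi.add_apply, Pi.sub_apply, Pi.zero_apply] at h hdeg
  omega

theorem exists_stabilizesTo_sink (hEul : Eulerian A) (hConn : Connected A) (z : V) (s : V → ℤ) :
    StabilizableVia A (fun i => i = z) s := by
  obtain ⟨g, hg⟩ := exists_lap_pos hEul hConn z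
  set k : ℤ := ∑ i, |s i| + 1 with hk
  set C : ℤ := ∑ i, |k * g i|
  refine stabilizableVia_of_stableOff (w := (fun _ => C) - k • g) (fun i => ?_) fun i hi => ?_
  · have h1 := Finset.single_le_sum (f := fun i => |k * g i|) (fun j _ => abs_nonneg _)
      (Finset.mem_univ i)
    have h2 := le_abs_self (k * g i)
    simp only [Pi.sub_apply, Pi.smul_apply, smul_eq_mul]
    linarith
  · have h1 := Finset.single_le_sum (f := fun i => |s i|) (fun j _ => abs_nonneg _)
      (Finset.mem_univ i)
    have h2 := le_abs_self (s i)
    have hk0 : 0 ≤ k := add_nonneg (Finset.sum_nonneg fun j _ => abs_nonneg _) zero_le_one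
    have h3 := mul_le_mul_of_nonneg_left (hg i hi) hk0
    rw [lap_sub, lap_const hEul, lap_smul]
    simp only [Pi.add_apply, Pi.sub_apply, Pi.smul_apply, smul_eq_mul, Pi.zero_apply]
    have h4 : (0 : ℤ) ≤ deg A i := by positivity
    linarith

theorem sinkStabilize_spec (hEul : Eulerian A) (hConn : Connected A) (z : V) (s : V → ℤ) :
    ∃ c : V → ℤ, (∀ i, 0 ≤ c i) ∧ c z = 0 ∧ sinkStabilize A z s = s + lap A c ∧
      (∀ i, i ≠ z → sinkStabilize A z s i ≤ (deg A i : ℤ) - 1) ∧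
      (Burning A z s → Burning A z (sinkStabilize A z s)) := by
  have hex := exists_stabilizesTo_sink hEul hConn z s
  have hseq : stabSeq A (fun i => i = z) s = hex.choose := dif_pos hex
  obtain ⟨hl, hl'⟩ := hex.choose_spec
  have heq : sinkStabilize A z s = s + lap A (counts hex.choose) := by
    rw [sinkStabilize, stabilizeVia, hseq, applySeq_eq]
  refine ⟨counts hex.choose, counts_nonneg _, hl.counts_eq_zero rfl, heq, fun i hi => ?_,
    fun hb => heq ▸ hb.add_lap_counts hl⟩
  rw [heq, ← applySeq_eq]
  exact hl' i hi

/-- Resetting the value at the sink after sink stabilization of a burning sandpile. -/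
theorem zRec_reset (hEul : Eulerian A) (hConn : Connected A) {s : V → ℤ} (hs : Burning A z s) :
    ZRec A z (fun j => if j = z then (deg A z : ℤ) else sinkStabilize A z s j) := by
  obtain ⟨c, -, -, -, hst, hb⟩ := sinkStabilize_spec hEul hConn z s
  refine zRec_of_burning hEul (by simp) (fun i hi => by simpa [hi] using hst i hi)
    ((hb hs).mono fun i hi => by simp [hi])

theorem reset_eq (z : V) (σ : V → ℤ) (d : ℤ) :
    (fun j => if j = z then d else σ j) = σ + (d - σ z) • delta z := by
  funext j
  by_cases h : j = z
  · subst h; simp [delta_self]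
  · simp [h, delta_of_ne h]

theorem exists_zDecomp (hEul : Eulerian A) (hConn : Connected A) (z : V) (s : V → ℤ) :
    ∃ ρ m v, ZDecomp A z s ρ m v := by
  obtain ⟨g, hg⟩ := exists_lap_pos hEul hConn z
  set k : ℤ := ∑ i, (|s i| + deg A i) with hk
  have hk0 : 0 ≤ k := Finset.sum_nonneg fun j _ => by positivity
  have hb : Burning A z (s + lap A (k • g)) := by
    refine burning_of_deg_le hEul fun i hi => ?_
    have h1 := Finset.single_le_sum (f := fun i => |s i| + (deg A i : ℤ))
      (fun j _ => by positivity) (Finset.mem_univ i)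
    have h2 := neg_abs_le (s i)
    have h3 := mul_le_mul_of_nonneg_left (hg i hi) hk0
    rw [lap_smul]
    simp only [Pi.add_apply, Pi.smul_apply, smul_eq_mul]
    linarith
  have hrec := zRec_reset hEul hConn hb
  obtain ⟨c, -, -, hc, -⟩ := sinkStabilize_spec hEul hConn z (s + lap A (k • g))
  rw [reset_eq] at hrec
  generalize (deg A z : ℤ) - sinkStabilize A z (s + lap A (k • g)) z = d at hrec
  rw [hc] at hrec
  refine ⟨_, -d, (fun _ => (c + k • g) z) - (c + k • g), hrec, by simp, fun j => ?_⟩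
  rw [lap_sub, lap_const hEul, lap_add]
  simp only [Pi.add_apply, Pi.sub_apply, Pi.smul_apply, smul_eq_mul, Pi.zero_apply]
  ring

theorem nonpos_of_zRec (hEul : Eulerian A) {ρ ρ' v : V → ℤ} {m : ℤ} (hρ : ZRec A z ρ)
    (hρ' : ZRec A z ρ') (hv : v z = 0) (h : ρ = ρ' + m • delta z + lap A v) (i : V) :
    v i ≤ 0 := by
  by_contra! hi
  obtain ⟨j, hj, hdeg⟩ := hρ.burning hEul v hv ⟨i, hi⟩
  have := hρ'.2.1 j hj
  rw [h] at hdeg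
  simp only [Pi.add_apply, Pi.smul_apply, delta_of_ne hj, smul_eq_mul, mul_zero] at hdeg
  omega

theorem ZRec.eq_of_equiv (hEul : Eulerian A) {ρ ρ' v : V → ℤ} {m : ℤ} (hρ : ZRec A z ρ)
    (hρ' : ZRec A z ρ') (hv : v z = 0) (h : ρ = ρ' + m • delta z + lap A v) : ρ = ρ' := by
  have h1 := nonpos_of_zRec hEul hρ hρ' hv h
  have h2 := nonpos_of_zRec hEul (v := -v) (m := -m) hρ' hρ (by simp [hv])
    (by rw [h, lap_neg, neg_smul]; abel)
  have hv0 : v = 0 := by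
    funext i
    have := h2 i
    simp only [Pi.neg_apply] at this
    exact le_antisymm (h1 i) (by simp only [Pi.zero_apply]; omega)
  rw [hv0, lap_zero, add_zero] at h
  have hz := congrFun h z
  simp only [Pi.add_apply, Pi.smul_apply, delta_self, smul_eq_mul, mul_one, hρ.1, hρ'.1] at hz
  have : m = 0 := by omega
  rw [h, this, zero_smul, add_zero]

theorem ZRec.nonneg (hEul : Eulerian A) {ρ : V → ℤ} (hρ : ZRec A z ρ) (i : V) : 0 ≤ ρ i := by
  by_cases hi : i = z
  · rw [hi, hρ.1]; positivity
  · obtain ⟨j, hj, hdeg⟩ := hρ.burning hEul (delta i) (delta_of_ne (Ne.symm hi))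
      ⟨i, by rw [delta_self]; norm_num⟩
    by_cases hji : j = i
    · subst hji
      have : lap A (delta j) j = -(deg A j : ℤ) + A j j := by simp [lap, delta]
      rw [this] at hdeg
      have : (0 : ℤ) ≤ A j j := by positivity
      omega
    · have h1 := lap_nonneg_of_eq_zero (A := A) (delta_nonneg i) (delta_of_ne hji)
      have h2 := hρ.2.1 j hj
      omega

theorem finite_setOf_zRec (hEul : Eulerian A) (z : V) : {ρ : V → ℤ | ZRec A z ρ}.Finite := by
  refine (Set.finite_Icc (0 : V → ℤ) fun i => (deg A i : ℤ)).subset fun ρ hρ =>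
    ⟨fun i => ZRec.nonneg hEul hρ i, fun i => ?_⟩
  by_cases hi : i = z
  · rw [hi]; exact hρ.1.le
  · exact (hρ.2.1 i hi).trans (sub_le_self _ zero_le_one)

end Recurrence

section SandpileGroup

variable {V : Type*} [Fintype V] [DecidableEq V] {A : V → V → ℕ} {z : V}

/-- The sandpile group: integer configurations modulo the Laplacian and the sink. -/
abbrev SandpileGroup (A : V → V → ℕ) (z : V) : Type _ :=
  (V → ℤ) ⧸ ((LinearMap.range (lapLin A)).toAddSubgroup ⊔ AddSubgroup.zmultiples (delta z))

/-- The class of a sandpile in the sandpile group. -/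
def cls (A : V → V → ℕ) (z : V) : (V → ℤ) →+ SandpileGroup A z := QuotientAddGroup.mk' _

theorem cls_surjective : Function.Surjective (cls A z) := QuotientAddGroup.mk'_surjective _

theorem cls_eq_zero_iff {s : V → ℤ} :
    cls A z s = 0 ↔ ∃ (m : ℤ) (v : V → ℤ), s = m • delta z + lap A v := by
  rw [cls, QuotientAddGroup.mk'_apply, QuotientAddGroup.eq_zero_iff, AddSubgroup.mem_sup]
  constructor
  · rintro ⟨_, ⟨v, rfl⟩, _, ⟨m, rfl⟩, rfl⟩
    exact ⟨m, v, add_comm _ _⟩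
  · rintro ⟨m, v, rfl⟩
    exact ⟨_, ⟨v, rfl⟩, _, ⟨m, rfl⟩, add_comm _ _⟩

theorem cls_lap (v : V → ℤ) : cls A z (lap A v) = 0 := cls_eq_zero_iff.2 ⟨0, v, by simp⟩

theorem cls_delta_sink : cls A z (delta z) = 0 :=
  cls_eq_zero_iff.2 ⟨1, 0, by rw [lap_zero]; simp⟩

theorem ZRec.eq_of_cls_eq (hEul : Eulerian A) {ρ ρ' : V → ℤ} (hρ : ZRec A z ρ)
    (hρ' : ZRec A z ρ') (h : cls A z ρ = cls A z ρ') : ρ = ρ' := by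
  rw [← sub_eq_zero, ← map_sub, cls_eq_zero_iff] at h
  obtain ⟨m, v, h⟩ := h
  refine hρ.eq_of_equiv hEul hρ' (v := v - fun _ => v z) (m := m) (by simp) ?_
  rw [lap_sub, lap_const hEul, sub_zero, add_assoc, ← h]
  abel

theorem zRec_Rz (hEul : Eulerian A) (hConn : Connected A) (s : V → ℤ) : ZRec A z (Rz A z s) := by
  have h := exists_zDecomp hEul hConn z s
  rw [Rz, dif_pos h]
  obtain ⟨m, v, h⟩ := h.choose_spec
  exact h.1

theorem Rz_spec (hEul : Eulerian A) (hConn : Connected A) (s : V → ℤ) :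
    ∃ (m : ℤ) (v : V → ℤ), v z = 0 ∧ s = Rz A z s + m • delta z + lap A v := by
  have h := exists_zDecomp hEul hConn z s
  have hR : Rz A z s = h.choose := dif_pos h
  obtain ⟨m, v, h⟩ := h.choose_spec
  rw [hR]
  exact ⟨m, v, h.2.1, funext h.2.2⟩

theorem cls_Rz (hEul : Eulerian A) (hConn : Connected A) (s : V → ℤ) :
    cls A z (Rz A z s) = cls A z s := by
  obtain ⟨m, v, -, h⟩ := Rz_spec (z := z) hEul hConn s
  conv_rhs => rw [h]
  rw [map_add, map_add, map_zsmul, cls_lap, cls_delta_sink]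
  simp

theorem Rz_eq_iff (hEul : Eulerian A) (hConn : Connected A) {s ρ : V → ℤ} (hρ : ZRec A z ρ) :
    Rz A z s = ρ ↔ cls A z s = cls A z ρ :=
  ⟨fun h => by rw [← h, cls_Rz hEul hConn], fun h =>
    (zRec_Rz hEul hConn s).eq_of_cls_eq hEul hρ (by rw [cls_Rz hEul hConn, h])⟩

theorem cls_bijective (hEul : Eulerian A) (hConn : Connected A) :
    Function.Bijective fun ρ : {ρ : V → ℤ // ZRec A z ρ} => cls A z ρ.1 := by
  refine ⟨fun ρ ρ' h => Subtype.ext (ρ.2.eq_of_cls_eq hEul ρ'.2 h), fun x => ?_⟩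
  obtain ⟨s, rfl⟩ := cls_surjective x
  exact ⟨⟨_, zRec_Rz hEul hConn s⟩, cls_Rz hEul hConn s⟩

theorem finite_sandpileGroup (hEul : Eulerian A) (hConn : Connected A) (z : V) :
    Finite (SandpileGroup A z) := by
  have : Finite {ρ : V → ℤ // ZRec A z ρ} := (finite_setOf_zRec hEul z).to_subtype
  exact Finite.of_surjective _ (cls_bijective hEul hConn).2

theorem kappa_eq_card (hEul : Eulerian A) (hConn : Connected A) (z : V) :
    kappa A z = Nat.card (SandpileGroup A z) :=
  Nat.card_eq_of_bijective _ (cls_bijective hEul hConn)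

theorem closure_range_cls_delta :
    AddSubgroup.closure (Set.range fun i => cls A z (delta i)) = ⊤ := by
  rw [eq_top_iff]
  rintro x -
  obtain ⟨s, rfl⟩ := cls_surjective x
  have hs : s = ∑ i, s i • delta i := by
    funext j
    simp [delta, Finset.sum_apply]
  rw [hs, map_sum]
  exact sum_mem fun i _ => by
    rw [map_zsmul]
    exact zsmul_mem (AddSubgroup.subset_closure (Set.mem_range_self i)) _

end SandpileGroup

section Operators

variable {V : Type*} [Fintype V] [DecidableEq V] {A : V → V → ℕ} {z : V}

theorem totalMass_add (s t : V → ℤ) : totalMass (s + t) = totalMass s + totalMass t :=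
  Finset.sum_add_distrib

theorem totalMass_lap (v : V → ℤ) : totalMass (lap A v) = 0 := sum_lap A v

theorem totalMass_smul_delta (m : ℤ) (i : V) : totalMass (m • delta i) = m := by
  simp only [totalMass, Pi.smul_apply, smul_eq_mul, ← Finset.mul_sum, sum_delta, mul_one]

theorem totalMass_delta (i : V) : totalMass (delta i) = 1 := sum_delta i

/-- Stabilizability is decided by the mass excess over the recurrent representative. -/
theorem stabilizable_iff (hEul : Eulerian A) (hConn : Connected A) (z : V) (s : V → ℤ) :
    Stabilizable A s ↔ totalMass s < totalMass (Rz A z s) := by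
  obtain ⟨m, v, hv, h⟩ := Rz_spec (z := z) hEul hConn s
  have hρ : ZRec A z (Rz A z s) := zRec_Rz hEul hConn s
  generalize Rz A z s = ρ at h hρ
  have hm : totalMass s = totalMass ρ + m := by
    rw [h, totalMass_add, totalMass_add, totalMass_smul_delta, totalMass_lap, add_zero]
  rw [hm]
  constructor
  · rintro ⟨l, hl, hst⟩
    by_contra! hm0
    rw [applySeq_eq, h, add_assoc, ← lap_add] at hst
    set u := v + counts l
    by_cases hu : ∃ i, u i < u z
    · obtain ⟨i, hi, hdeg⟩ := hρ.burning hEul ((fun _ => u z) - u) (by simp)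
        (hu.imp fun i hi => by simpa using hi)
      have := hst i not_false
      rw [lap_sub, lap_const hEul] at hdeg
      simp only [Pi.add_apply, Pi.sub_apply, Pi.zero_apply, Pi.smul_apply, smul_eq_mul,
        delta_of_ne hi, mul_zero] at hdeg this
      omega
    · push Not at hu
      have h0 := lap_nonneg_of_isMin hEul hu
      have := hst z not_false
      simp only [Pi.add_apply, Pi.smul_apply, smul_eq_mul, delta_self, hρ.1, mul_one] at this
      omega
  · intro hm0
    refine stabilizableVia_of_stableOff (w := (fun _ => ∑ i, |v i|) - v) (fun i => ?_) fun i _ => ?_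
    · have h1 := Finset.single_le_sum (f := fun i => |v i|) (fun j _ => abs_nonneg _)
        (Finset.mem_univ i)
      have h2 := le_abs_self (v i)
      simp only [Pi.sub_apply]
      linarith
    · rw [h, lap_sub, lap_const hEul]
      simp only [Pi.add_apply, Pi.sub_apply, Pi.smul_apply, smul_eq_mul, Pi.zero_apply]
      by_cases hi : i = z
      · subst hi
        rw [hρ.1, delta_self]
        omega
      · have := hρ.2.1 i hi
        rw [delta_of_ne hi]
        omega

theorem openAdd_spec (hEul : Eulerian A) (hConn : Connected A) {ρ : V → ℤ} (hρ : ZRec A z ρ)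
    (i : V) : ZRec A z (openAdd A z i ρ) ∧ cls A z (openAdd A z i ρ) = cls A z (ρ + delta i) ∧
      totalMass (openAdd A z i ρ) ≤ totalMass ρ + 1 := by
  obtain ⟨c, hc, hcz, heq, -, -⟩ := sinkStabilize_spec hEul hConn z (ρ + delta i)
  have hopen : openAdd A z i ρ =
      fun j => if j = z then (deg A z : ℤ) else sinkStabilize A z (ρ + delta i) j := rfl
  refine ⟨hopen ▸ zRec_reset hEul hConn ((hρ.burning hEul).mono fun j _ =>
    le_add_of_nonneg_right (delta_nonneg i j)), ?_, ?_⟩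
  · rw [hopen, reset_eq, map_add, map_zsmul, cls_delta_sink, heq, map_add, cls_lap]
    simp
  · rw [hopen, reset_eq, totalMass_add, totalMass_smul_delta, heq, totalMass_add, totalMass_add,
      totalMass_lap, totalMass_delta]
    have h1 := lap_nonneg_of_eq_zero (A := A) hc hcz
    have h2 := delta_nonneg i z
    simp only [Pi.add_apply, hρ.1]
    omega

theorem openAddInv_spec (hEul : Eulerian A) (hConn : Connected A) {ρ : V → ℤ} (hρ : ZRec A z ρ)
    (i : V) : ZRec A z (openAddInv A z i ρ) ∧ openAdd A z i (openAddInv A z i ρ) = ρ := by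
  have h : ∃ ρ', ZRec A z ρ' ∧ openAdd A z i ρ' = ρ := by
    have hR := zRec_Rz (z := z) hEul hConn (ρ - delta i)
    obtain ⟨h1, h2, -⟩ := openAdd_spec hEul hConn hR i
    refine ⟨_, hR, h1.eq_of_cls_eq hEul hρ ?_⟩
    rw [h2, map_add, cls_Rz hEul hConn, ← map_add, sub_add_cancel]
  rw [openAddInv, dif_pos h]
  exact h.choose_spec

theorem cls_openAddInv (hEul : Eulerian A) (hConn : Connected A) {ρ : V → ℤ} (hρ : ZRec A z ρ)
    (i : V) : cls A z (openAddInv A z i ρ) = cls A z ρ - cls A z (delta i) := by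
  obtain ⟨h1, h2⟩ := openAddInv_spec hEul hConn hρ i
  have h := (openAdd_spec hEul hConn h1 i).2.1
  rw [h2, map_add] at h
  rw [h, add_sub_cancel_right]

theorem burst_nonneg (hEul : Eulerian A) (hConn : Connected A) {ρ : V → ℤ} (hρ : ZRec A z ρ)
    (i : V) : 0 ≤ burst A z i ρ := by
  obtain ⟨h1, h2⟩ := openAddInv_spec hEul hConn hρ i
  have h := (openAdd_spec hEul hConn h1 i).2.2
  rw [h2] at h
  rw [burst]
  omega

theorem exists_chain_eq (s₀ : V → ℤ) (w : List V) :
    ∃ u : V → ℤ, chain A s₀ w = s₀ + (w.map delta).sum + lap A u := by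
  have hadd : ∀ (s : V → ℤ) (i : V), ∃ u, closedAdd A i s = s + delta i + lap A u := by
    intro s i
    rw [closedAdd]
    split_ifs
    · exact ⟨_, applySeq_eq _ _⟩
    · exact ⟨0, by rw [lap_zero, add_zero]; rfl⟩
  induction w generalizing s₀ with
  | nil => exact ⟨0, by simp [chain, lap_zero]⟩
  | cons i w ih =>
    obtain ⟨u, hu⟩ := hadd s₀ i
    obtain ⟨v, hv⟩ := ih (closedAdd A i s₀)
    refine ⟨u + v, ?_⟩
    have : chain A s₀ (i :: w) = chain A (closedAdd A i s₀) w := rfl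
    rw [this, hv, hu, List.map_cons, List.sum_cons, lap_add]
    abel

theorem cls_chain (s₀ : V → ℤ) (w : List V) :
    cls A z (chain A s₀ w) = cls A z s₀ + (w.map fun i => cls A z (delta i)).sum := by
  obtain ⟨u, hu⟩ := exists_chain_eq (A := A) s₀ w
  rw [hu, map_add, map_add, cls_lap, add_zero, map_list_sum, List.map_map]
  rfl

theorem totalMass_chain (s₀ : V → ℤ) (w : List V) :
    totalMass (chain A s₀ w) = totalMass s₀ + w.length := by
  obtain ⟨u, hu⟩ := exists_chain_eq (A := A) s₀ w
  rw [hu, totalMass_add, totalMass_add, totalMass_lap, add_zero]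
  congr 1
  clear hu u
  induction w with
  | nil => simp [totalMass]
  | cons i w ih =>
    rw [List.map_cons, List.sum_cons, totalMass_add, totalMass_delta]
    rw [ih, List.length_cons]
    push_cast
    ring

theorem openAddInv_Rz_chain (hEul : Eulerian A) (hConn : Connected A) (s₀ : V → ℤ) (w : List V)
    (i : V) : openAddInv A z i (Rz A z (chain A s₀ (w ++ [i]))) = Rz A z (chain A s₀ w) := by
  have hR := zRec_Rz (z := z) hEul hConn (chain A s₀ (w ++ [i]))
  refine (openAddInv_spec hEul hConn hR i).1.eq_of_cls_eq hEul (zRec_Rz hEul hConn _) ?_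
  rw [cls_openAddInv hEul hConn hR, cls_Rz hEul hConn, cls_Rz hEul hConn, cls_chain, cls_chain]
  simp [add_sub_assoc]

theorem stabilizable_of_append (hEul : Eulerian A) (hConn : Connected A) (z : V) (s₀ : V → ℤ)
    (w w' : List V) (h : Stabilizable A (chain A s₀ (w ++ w'))) :
    Stabilizable A (chain A s₀ w) := by
  induction w' using List.reverseRecOn with
  | nil => simpa using h
  | append_singleton w' i ih =>
    refine ih ?_
    rw [← List.append_assoc, stabilizable_iff hEul hConn z, totalMass_chain] at h
    rw [stabilizable_iff hEul hConn z, totalMass_chain]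
    have hb := burst_nonneg hEul hConn (zRec_Rz (z := z) hEul hConn
      (chain A s₀ (w ++ w' ++ [i]))) i
    rw [burst, openAddInv_Rz_chain hEul hConn] at hb
    simp only [List.length_append, List.length_singleton] at h ⊢
    push_cast at h ⊢
    omega

theorem isThresholdWord_append_singleton (hEul : Eulerian A) (hConn : Connected A) (z : V)
    (s₀ : V → ℤ) (w : List V) (i : V) :
    IsThresholdWord A s₀ (w ++ [i]) ↔
      ¬ Stabilizable A (chain A s₀ (w ++ [i])) ∧ Stabilizable A (chain A s₀ w) := by
  refine and_congr_right fun _ => ⟨fun h => h w (List.prefix_append _ _) (by simp), ?_⟩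
  intro h w' hw' hne
  rw [List.prefix_concat_iff] at hw'
  obtain ⟨t, rfl⟩ := hw'.resolve_left (by simpa using hne)
  exact stabilizable_of_append hEul hConn z s₀ w' t h

/-- The threshold is crossed by adding at `i` with representative `ρ` exactly when the chain
arrives from `â_i⁻¹ ρ` within a time window of length the burst size. -/
theorem isThresholdWord_append_singleton_iff (hEul : Eulerian A) (hConn : Connected A)
    {ρ : V → ℤ} (hρ : ZRec A z ρ) (s₀ : V → ℤ) (w : List V) (i : V) :
    IsThresholdWord A s₀ (w ++ [i]) ∧ Rz A z (chain A s₀ (w ++ [i])) = ρ ↔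
      (totalMass ρ - totalMass s₀ ≤ w.length + 1 ∧
        w.length + 1 < totalMass ρ - totalMass s₀ + burst A z i ρ) ∧
      cls A z (chain A s₀ w) = cls A z ρ - cls A z (delta i) := by
  have hcls : Rz A z (chain A s₀ (w ++ [i])) = ρ ↔
      cls A z (chain A s₀ w) = cls A z ρ - cls A z (delta i) := by
    rw [Rz_eq_iff hEul hConn hρ, cls_chain, cls_chain, eq_sub_iff_add_eq]
    simp [add_assoc]
  rw [← hcls]
  refine and_congr_left fun h => ?_
  have hinv := openAddInv_Rz_chain (z := z) hEul hConn s₀ w i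
  rw [isThresholdWord_append_singleton hEul hConn z, stabilizable_iff hEul hConn z,
    stabilizable_iff hEul hConn z, ← hinv, h, totalMass_chain, totalMass_chain, burst]
  simp only [List.length_append, List.length_singleton]
  push_cast
  omega

end Operators

section RandomWalk

variable {V G : Type*} [Fintype V] [AddCommGroup G]

/-- The law after `k` steps of the random walk on `G` started at `0` whose increments are `d i` with
probability `α i`. -/
def walk (α : V → ℝ) (d : V → G) : ℕ → G → ℝ
  | 0, x => if x = 0 then 1 else 0
  | k + 1, x => ∑ i, α i * walk α d k (x - d i)

variable {α : V → ℝ} {d : V → G}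

theorem walk_succ (k : ℕ) (x : G) : walk α d (k + 1) x = ∑ i, α i * walk α d k (x - d i) := rfl

theorem walk_nonneg (hα : ∀ i, 0 < α i) (k : ℕ) (x : G) : 0 ≤ walk α d k x := by
  induction k generalizing x with
  | zero => rw [walk]; split_ifs <;> norm_num
  | succ k ih => exact Finset.sum_nonneg fun i _ => mul_nonneg (hα i).le (ih _)

theorem walk_succ_pos (hα : ∀ i, 0 < α i) {k : ℕ} {x : G} (i : V) (h : 0 < walk α d k x) :
    0 < walk α d (k + 1) (x + d i) := by
  rw [walk_succ]
  refine Finset.sum_pos' (fun j _ => mul_nonneg (hα j).le (walk_nonneg hα _ _))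
    ⟨i, Finset.mem_univ i, mul_pos (hα i) ?_⟩
  rwa [add_sub_cancel_right]

variable [Fintype G]

theorem sum_walk (hsum : ∑ i, α i = 1) (k : ℕ) : ∑ x, walk α d k x = 1 := by
  induction k with
  | zero => simp [walk]
  | succ k ih =>
    simp only [walk_succ]
    rw [Finset.sum_comm]
    simp only [← Finset.mul_sum]
    have h : ∀ i, ∑ x, walk α d k (x - d i) = 1 := fun i => by
      rw [← ih]; exact Equiv.sum_comp (Equiv.subRight (d i)) (walk α d k)
    simp [h, hsum]

theorem walk_add (k N : ℕ) (x : G) :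
    walk α d (k + N) x = ∑ g, walk α d N g * walk α d k (x - g) := by
  induction N generalizing x with
  | zero => simp [walk]
  | succ N ih =>
    rw [← add_assoc, walk_succ]
    simp only [walk_succ, ih, Finset.mul_sum, Finset.sum_mul]
    rw [Finset.sum_comm (s := (Finset.univ : Finset G))]
    refine Finset.sum_congr rfl fun i _ => ?_
    rw [← Equiv.sum_comp (Equiv.subRight (d i))]
    refine Finset.sum_congr rfl fun g _ => ?_
    rw [Equiv.subRight_apply, sub_sub, add_sub_cancel, mul_assoc]

theorem exists_walk_pos (hα : ∀ i, 0 < α i) (hd : AddSubgroup.closure (Set.range d) = ⊤)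
    (x : G) : ∃ k, 0 < walk α d k x := by
  have hx : x ∈ AddSubmonoid.closure (Set.range d) := by
    rw [← AddSubgroup.closure_toAddSubmonoid_of_finite, hd]
    trivial
  induction hx using AddSubmonoid.closure_induction_right with
  | zero => exact ⟨0, by simp [walk]⟩
  | add_right x hx y hy ih =>
    obtain ⟨i, rfl⟩ := hy
    obtain ⟨k, hk⟩ := ih
    exact ⟨k + 1, walk_succ_pos hα i hk⟩

theorem exists_forall_walk_pos (hα : ∀ i, 0 < α i)
    (hd : AddSubgroup.closure (Set.range d) = ⊤) {z : V} (hz : d z = 0) :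
    ∃ N, ∀ x, 0 < walk α d N x := by
  choose k hk using exists_walk_pos (α := α) hα hd
  have hmono : ∀ x n, 0 < walk α d (k x + n) x := by
    intro x n
    induction n with
    | zero => exact hk x
    | succ n ih => simpa [hz, ← add_assoc] using walk_succ_pos hα z ih
  refine ⟨∑ x, k x, fun x => ?_⟩
  obtain ⟨n, hn⟩ := Nat.exists_eq_add_of_le (Finset.single_le_sum (f := k)
    (fun _ _ => Nat.zero_le _) (Finset.mem_univ x))
  rw [hn]
  exact hmono x n

theorem walk_le_one (hα : ∀ i, 0 < α i) (hsum : ∑ i, α i = 1) (k : ℕ) (x : G) :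
    walk α d k x ≤ 1 := by
  rw [← sum_walk (d := d) hsum k]
  exact Finset.single_le_sum (fun y _ => walk_nonneg hα k y) (Finset.mem_univ x)

theorem exists_contraction (hα : ∀ i, 0 < α i) (hsum : ∑ i, α i = 1)
    (hd : AddSubgroup.closure (Set.range d) = ⊤) {z : V} (hz : d z = 0) :
    ∃ (N : ℕ) (r : ℝ), 0 ≤ r ∧ r < 1 ∧ ∀ j k (x y : G),
      |walk α d (k + j * N) x - walk α d (k + j * N) y| ≤ r ^ j := by
  obtain ⟨N, hN⟩ := exists_forall_walk_pos hα hd hz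
  obtain ⟨g₀, -, hg₀⟩ := Finset.exists_min_image Finset.univ (walk α d N) ⟨0, Finset.mem_univ _⟩
  set c := walk α d N g₀
  have hc : 0 < c := hN g₀
  have hq : ∀ g, 0 ≤ walk α d N g - c := fun g => sub_nonneg.2 (hg₀ g (Finset.mem_univ g))
  have hqsum : ∑ g, (walk α d N g - c) = 1 - Fintype.card G * c := by
    rw [Finset.sum_sub_distrib, sum_walk hsum]; simp
  have hcard : (0 : ℝ) < Fintype.card G := by exact_mod_cast Fintype.card_pos
  refine ⟨N, 1 - Fintype.card G * c, hqsum ▸ Finset.sum_nonneg fun g _ => hq g,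
    sub_lt_self _ (mul_pos hcard hc), fun j => ?_⟩
  induction j with
  | zero =>
    intro k x y
    rw [pow_zero, abs_le]
    have h1 := walk_nonneg (d := d) hα (k + 0 * N)
    have h2 := walk_le_one (d := d) hα hsum (k + 0 * N)
    constructor <;> linarith [h1 x, h1 y, h2 x, h2 y]
  | succ j ih =>
    intro k x y
    have hshift : ∀ x, ∑ g, walk α d (k + j * N) (x - g) = 1 := fun x => by
      rw [← sum_walk (d := d) hsum (k + j * N)]
      exact Equiv.sum_comp (Equiv.subLeft x) (walk α d (k + j * N))
    have hsplit : ∀ x, walk α d (k + (j + 1) * N) x =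
        ∑ g, (walk α d N g - c) * walk α d (k + j * N) (x - g) + c := fun x => by
      rw [show k + (j + 1) * N = k + j * N + N by ring, walk_add]
      simp only [sub_mul, Finset.sum_sub_distrib, ← Finset.mul_sum, hshift]
      ring
    rw [hsplit, hsplit, add_sub_add_right_eq_sub, ← Finset.sum_sub_distrib]
    refine (Finset.abs_sum_le_sum_abs _ _).trans ?_
    rw [pow_succ', ← hqsum, Finset.sum_mul]
    refine Finset.sum_le_sum fun g _ => ?_
    rw [← mul_sub, abs_mul, abs_of_nonneg (hq g)]
    exact mul_le_mul_of_nonneg_left (hqsum ▸ ih k _ _) (hq g)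

/-- A lazy generating random walk on a finite abelian group converges to the uniform law. -/
theorem exists_forall_abs_walk_sub_le (hα : ∀ i, 0 < α i) (hsum : ∑ i, α i = 1)
    (hd : AddSubgroup.closure (Set.range d) = ⊤) {z : V} (hz : d z = 0) {ε : ℝ} (hε : 0 < ε) :
    ∃ M, ∀ n, M ≤ n → ∀ x, |walk α d n x - 1 / Fintype.card G| ≤ ε := by
  obtain ⟨N, r, hr0, hr1, hr⟩ := exists_contraction hα hsum hd hz
  obtain ⟨j, hj⟩ := exists_pow_lt_of_lt_one hε hr1
  have hcard : (0 : ℝ) < Fintype.card G := by exact_mod_cast Fintype.card_pos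
  refine ⟨j * N, fun n hn x => ?_⟩
  obtain ⟨k, rfl⟩ := Nat.exists_eq_add_of_le' hn
  have havg : walk α d (k + j * N) x - 1 / Fintype.card G =
      (∑ y, (walk α d (k + j * N) x - walk α d (k + j * N) y)) / Fintype.card G := by
    rw [Finset.sum_sub_distrib, sum_walk hsum]
    simp only [Finset.sum_const, Finset.card_univ, nsmul_eq_mul]
    field_simp
  rw [havg, abs_div, abs_of_pos hcard, div_le_iff₀ hcard]
  refine (Finset.abs_sum_le_sum_abs _ _).trans ?_
  refine (Finset.sum_le_sum fun y _ => (hr j k x y).trans hj.le).trans ?_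
  simp [mul_comm]

end RandomWalk

section Words

variable {V : Type*} [Fintype V]

theorem append_singleton_injective (V : Type*) :
    Function.Injective fun p : List V × V => p.1 ++ [p.2] := by
  intro p q h
  obtain ⟨h1, h2⟩ := List.append_inj' h rfl
  exact Prod.ext h1 (by simpa using h2)

/-- The words of length `k`. -/
def words (V : Type*) [Fintype V] : ℕ → Finset (List V)
  | 0 => {[]}
  | k + 1 => (words V k ×ˢ Finset.univ).map ⟨_, append_singleton_injective V⟩

theorem mem_words {k : ℕ} {w : List V} : w ∈ words V k ↔ w.length = k := by
  induction k generalizing w with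
  | zero => simp [words]
  | succ k ih =>
    simp only [words, Finset.mem_map, Finset.mem_product, Finset.mem_univ, and_true, ih,
      Function.Embedding.coeFn_mk, Prod.exists]
    constructor
    · rintro ⟨w, i, rfl, rfl⟩
      simp
    · intro h
      induction w using List.reverseRecOn with
      | nil => simp at h
      | append_singleton w i _ => exact ⟨w, i, by simpa using h, rfl⟩

theorem sum_words_succ (k : ℕ) (f : List V → ℝ) :
    ∑ w ∈ words V (k + 1), f w = ∑ w ∈ words V k, ∑ i, f (w ++ [i]) := by
  rw [words, Finset.sum_map, Finset.sum_product]
  rfl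

theorem tsum_list_eq {f : List V → ℝ} {N : ℕ} (h0 : f [] = 0)
    (hN : ∀ w i, N ≤ w.length → f (w ++ [i]) = 0) :
    ∑' w, f w = ∑ k ∈ Finset.range N, ∑ w ∈ words V k, ∑ i, f (w ++ [i]) := by
  rw [tsum_eq_sum (s := (Finset.range N).biUnion fun k => words V (k + 1)), Finset.sum_biUnion]
  · exact Finset.sum_congr rfl fun k _ => sum_words_succ k f
  · intro k _ l _ hkl
    refine Finset.disjoint_left.2 fun w hk hl => hkl ?_
    rw [mem_words] at hk hl
    omega
  · intro w hw
    simp only [Finset.mem_biUnion, Finset.mem_range, mem_words, not_exists, not_and] at hw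
    induction w using List.reverseRecOn with
    | nil => exact h0
    | append_singleton w i _ =>
      exact hN w i (by by_contra! h; exact hw w.length h (by simp))

theorem wordProb_append_singleton (α : V → ℝ) (w : List V) (i : V) :
    wordProb α (w ++ [i]) = wordProb α w * α i := by
  simp [wordProb]

theorem sum_words_eq_walk {G : Type*} [AddCommGroup G] (α : V → ℝ) (d : V → G) (k : ℕ) (x y : G) :
    ∑ w ∈ words V k, (if y + (w.map d).sum = x then wordProb α w else 0) =
      walk α d k (x - y) := by
  induction k generalizing x with
  | zero => simp [words, walk, wordProb, sub_eq_zero, eq_comm]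
  | succ k ih =>
    rw [sum_words_succ, walk_succ, Finset.sum_comm]
    refine Finset.sum_congr rfl fun i _ => ?_
    rw [sub_right_comm, ← ih, Finset.mul_sum]
    refine Finset.sum_congr rfl fun w _ => ?_
    have : y + ((w ++ [i]).map d).sum = x ↔ y + (w.map d).sum = x - d i := by
      rw [eq_sub_iff_add_eq]; simp [add_assoc]
    simp only [this, wordProb_append_singleton, mul_ite, mul_zero, mul_comm]

end Words

section Threshold

variable {V : Type*} [Fintype V] [DecidableEq V] {A : V → V → ℕ} {z : V}

/-- The threshold law as a sum of probabilities of the random walk on the sandpile group. -/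
theorem thresholdProb_eq (hEul : Eulerian A) (hConn : Connected A) (α : V → ℝ) {ρ : V → ℤ}
    (hρ : ZRec A z ρ) (s₀ : V → ℤ) (hs₀ : totalMass s₀ < 0) {n : ℕ}
    (hn : totalMass ρ - totalMass s₀ = n + 1) :
    thresholdProb A α s₀ (fun w => Rz A z (chain A s₀ w) = ρ) =
      ∑ i, α i * ∑ k ∈ Finset.range (burst A z i ρ).toNat,
        walk α (fun i => cls A z (delta i)) (n + k)
          (cls A z ρ - cls A z (delta i) - cls A z s₀) := by
  have hb := burst_nonneg hEul hConn hρ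
  set N : ℕ := n + ∑ i, (burst A z i ρ).toNat
  have hbN : ∀ i, n + (burst A z i ρ).toNat ≤ N := fun i =>
    Nat.add_le_add_left (Finset.single_le_sum (f := fun i => (burst A z i ρ).toNat)
      (fun _ _ => Nat.zero_le _) (Finset.mem_univ i)) n
  have hstep : ∀ (w : List V) (i : V)
      [Decidable (IsThresholdWord A s₀ (w ++ [i]) ∧ Rz A z (chain A s₀ (w ++ [i])) = ρ)], (if IsThresholdWord A s₀ (w ++ [i]) ∧ Rz A z (chain A s₀ (w ++ [i])) = ρ
      then wordProb α (w ++ [i]) else 0) =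
      if w.length ∈ Finset.Ico n (n + (burst A z i ρ).toNat) then
        α i * (if cls A z s₀ + (w.map fun i => cls A z (delta i)).sum =
          cls A z ρ - cls A z (delta i) then wordProb α w else 0) else 0 := by
    intro w i _
    have hiff : (totalMass ρ - totalMass s₀ ≤ w.length + 1 ∧
        w.length + 1 < totalMass ρ - totalMass s₀ + burst A z i ρ) ↔
        w.length ∈ Finset.Ico n (n + (burst A z i ρ).toNat) := by
      have := hb i
      rw [hn, Finset.mem_Ico]
      omega
    rw [← cls_chain]
    simp only [isThresholdWord_append_singleton_iff hEul hConn hρ, hiff, ite_and,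
      wordProb_append_singleton, mul_ite, mul_zero, mul_comm]
  rw [thresholdProb, tsum_list_eq (N := N)]
  · simp only [hstep]
    have hk : ∀ k, (∑ w ∈ words V k, ∑ i, if w.length ∈ Finset.Ico n (n + (burst A z i ρ).toNat) then
        α i * (if cls A z s₀ + (w.map fun i => cls A z (delta i)).sum =
          cls A z ρ - cls A z (delta i) then wordProb α w else 0) else 0) =
        ∑ i, if k ∈ Finset.Ico n (n + (burst A z i ρ).toNat) then
          α i * walk α (fun i => cls A z (delta i)) k
            (cls A z ρ - cls A z (delta i) - cls A z s₀) else 0 := by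
      intro k
      rw [Finset.sum_comm]
      refine Finset.sum_congr rfl fun i _ => ?_
      rw [← sum_words_eq_walk, Finset.mul_sum]
      split_ifs with h
      · refine Finset.sum_congr rfl fun w hw => ?_
        rw [mem_words.1 hw, if_pos h]
        congr
      · refine Finset.sum_eq_zero fun w hw => ?_
        rw [mem_words.1 hw, if_neg h]
    simp only [hk]
    rw [Finset.sum_comm]
    refine Finset.sum_congr rfl fun i _ => ?_
    rw [← Finset.sum_filter, ← Finset.mul_sum]
    congr 1
    have hfilter : (Finset.range N).filter (fun k => k ∈ Finset.Ico n (n + (burst A z i ρ).toNat)) =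
        Finset.Ico n (n + (burst A z i ρ).toNat) := by
      ext k
      have := hbN i
      simp only [Finset.mem_filter, Finset.mem_range, Finset.mem_Ico]
      omega
    rw [hfilter, Finset.sum_Ico_eq_sum_range, add_tsub_cancel_left]
  · rw [if_neg]
    rintro ⟨⟨h, -⟩, -⟩
    refine h ((stabilizable_iff hEul hConn z _).2 ?_)
    rw [totalMass_chain]
    have : 0 ≤ totalMass (Rz A z (chain A s₀ [])) :=
      Finset.sum_nonneg fun i _ => (zRec_Rz hEul hConn _).nonneg hEul i
    simp only [List.length_nil]
    push_cast
    omega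
  · intro w i hw
    rw [hstep, if_neg]
    have := hbN i
    simp only [Finset.mem_Ico]
    omega

end Threshold

end ThresholdState

open ThresholdState in
/-- The `z`-recurrent representative of the threshold state is the size-biasing
of the uniform distribution on `Rec(z)` by average burst size:
`P_{s0}{R_z(s_τ) = ρ} → (1/κ)·Σ_i α_i·av_{i→z}(ρ)` as `|s₀| → -∞`. -/
theorem statement_5 {V : Type*} [Fintype V] [DecidableEq V]
    (A : V → V → ℕ) (hEul : Eulerian A) (hConn : Connected A)
    (α : V → ℝ) (hαpos : ∀ j, 0 < α j) (hαsum : ∑ j, α j = 1)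
    (z : V) (ρ : V → ℤ) (hρ : ZRec A z ρ) :
    ∀ ε : ℝ, 0 < ε → ∃ K : ℤ, K < 0 ∧ ∀ s0 : V → ℤ, totalMass s0 < K →
      |thresholdProb A α s0 (fun w => Rz A z (chain A s0 w) = ρ)
        - (1 / (kappa A z : ℝ)) * ∑ i : V, α i * (burst A z i ρ : ℝ)| ≤ ε := by
  intro ε hε
  have hfin := finite_sandpileGroup hEul hConn z
  have : Fintype (SandpileGroup A z) := Fintype.ofFinite _
  set B : ℝ := ∑ i, α i * (burst A z i ρ : ℝ) with hB
  have hb : ∀ i, (0 : ℝ) ≤ burst A z i ρ := fun i => by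
    exact_mod_cast burst_nonneg hEul hConn hρ i
  have hB0 : 0 ≤ B := Finset.sum_nonneg fun i _ => mul_nonneg (hαpos i).le (hb i)
  obtain ⟨M, hM⟩ := exists_forall_abs_walk_sub_le hαpos hαsum
    (closure_range_cls_delta (A := A) (z := z)) (z := z) cls_delta_sink
    (div_pos hε (by linarith : 0 < B + 1))
  refine ⟨-(M + 1 : ℤ), by omega, fun s0 hs0 => ?_⟩
  have hρ0 : 0 ≤ totalMass ρ := Finset.sum_nonneg fun i _ => hρ.nonneg hEul i
  obtain ⟨n, hn⟩ := Int.eq_ofNat_of_zero_le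
    (by omega : 0 ≤ totalMass ρ - totalMass s0 - 1)
  have hMn : M ≤ n := by omega
  rw [thresholdProb_eq hEul hConn α hρ s0 (by omega) (n := n) (by omega),
    kappa_eq_card hEul hConn, Nat.card_eq_fintype_card, hB, Finset.mul_sum,
    ← Finset.sum_sub_distrib]
  have hterm : ∀ i ∈ Finset.univ, |α i * ∑ k ∈ Finset.range (burst A z i ρ).toNat,
        walk α (fun i => cls A z (delta i)) (n + k)
          (cls A z ρ - cls A z (delta i) - cls A z s0) -
        1 / (Fintype.card (SandpileGroup A z) : ℝ) * (α i * (burst A z i ρ : ℝ))| ≤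
      α i * (burst A z i ρ : ℝ) * (ε / (B + 1)) := by
    intro i _
    have hcast : (((burst A z i ρ).toNat : ℕ) : ℝ) = burst A z i ρ := by
      exact_mod_cast Int.toNat_of_nonneg (burst_nonneg hEul hConn hρ i)
    rw [mul_left_comm, ← mul_sub, abs_mul, abs_of_pos (hαpos i), mul_assoc, ← hcast]
    refine mul_le_mul_of_nonneg_left ?_ (hαpos i).le
    have hconst : 1 / (Fintype.card (SandpileGroup A z) : ℝ) * ((burst A z i ρ).toNat : ℝ) =
        ∑ _k ∈ Finset.range (burst A z i ρ).toNat,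
          1 / (Fintype.card (SandpileGroup A z) : ℝ) := by
      simp [mul_comm]
    rw [hconst, ← Finset.sum_sub_distrib]
    refine (Finset.abs_sum_le_sum_abs _ _).trans ?_
    refine (Finset.sum_le_sum fun k _ => hM (n + k) (by omega) _).trans ?_
    simp
  refine (Finset.abs_sum_le_sum_abs _ _).trans ((Finset.sum_le_sum hterm).trans ?_)
  rw [← Finset.sum_mul, ← hB, ← mul_div_assoc, div_le_iff₀ (by linarith)]
  nlinarith
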